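/- arXiv:1504.06298 — 10 statements merged into one kernel-verified Lean document; each statement's English description precedes it below -/
import Mathlib

section
/- If a convex, continuously differentiable function f is quasi-strongly convex on X with constant κ_f > 0, then f satisfies the quadratic under-approximation property on X with the same constant κ_f > 0, i.e., f(x) ≥ f* + ⟨∇f(x̄), x − x̄⟩ + (κ_f/2)‖x − x̄‖² for all x ∈ X. -/
open Set
open scoped InnerProductSpace

/-- A nearest point of a convex set satisfies the obtuse angle criterion. -/
theorem inner_sub_nonpos_of_forall_norm_sub_le {E : Type*} [NormedAddCommGroup E]
    [InnerProductSpace ℝ E] {K : Set E} (hK : Convex ℝ K) {x p : E} (hp : p ∈ K)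
    (h : ∀ y ∈ K, ‖x - p‖ ≤ ‖x - y‖) {y : E} (hy : y ∈ K) :
    ⟪x - p, y - p⟫_ℝ ≤ 0 := by
  refine (norm_eq_iInf_iff_real_inner_le_zero hK hp).1 (le_antisymm ?_ ?_) y hy
  · have : Nonempty K := ⟨⟨p, hp⟩⟩
    exact le_ciInf fun w => h w w.2
  · exact ciInf_le ⟨0, by rintro _ ⟨w, rfl⟩; exact norm_nonneg _⟩ (⟨p, hp⟩ : K)

/-- Points of the segment from `x` to its nearest point `p` in a convex set have `p` as their
only nearest point. -/
theorem eq_of_forall_norm_sub_le_of_mem_segment {E : Type*} [NormedAddCommGroup E]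
    [InnerProductSpace ℝ E] {K : Set E} (hK : Convex ℝ K) {x p q : E} {t : ℝ} (ht : 0 ≤ t)
    (hp : p ∈ K) (hxp : ∀ y ∈ K, ‖x - p‖ ≤ ‖x - y‖) (hq : q ∈ K)
    (hxq : ∀ y ∈ K, ‖p + t • (x - p) - q‖ ≤ ‖p + t • (x - p) - y‖) : q = p := by
  have h₁ := inner_sub_nonpos_of_forall_norm_sub_le hK hp hxp hq
  have h₂ := inner_sub_nonpos_of_forall_norm_sub_le hK hq hxq hp
  have h₃ : p + t • (x - p) - q = (p - q) + t • (x - p) := by abel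
  rw [h₃, inner_add_left, real_inner_smul_left, real_inner_self_eq_norm_sq] at h₂
  rw [← neg_sub p q, inner_neg_right] at h₁
  have h₄ : ‖p - q‖ ^ 2 ≤ 0 := by nlinarith
  have h₅ : ‖p - q‖ = 0 := pow_eq_zero_iff two_ne_zero |>.1 (le_antisymm h₄ (sq_nonneg _))
  exact (sub_eq_zero.1 (norm_eq_zero.1 h₅)).symm

/-- If `φ t - φ 0 + D t² ≤ t φ' t` on `(0, 1]`, then `t ↦ (φ t - φ 0) / t - D t` is monotone
there, and comparing its value at `1` with its limit at `0` bounds `φ 1` from below. -/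
theorem add_deriv_zero_add_le_of_sub_add_le_mul_deriv {φ φ' : ℝ → ℝ} {D : ℝ}
    (hφ : ∀ t, HasDerivAt φ (φ' t) t)
    (h : ∀ t ∈ Ioc (0 : ℝ) 1, φ t - φ 0 + D * t ^ 2 ≤ t * φ' t) :
    φ 0 + φ' 0 + D ≤ φ 1 := by
  let ψ : ℝ → ℝ := fun t => (φ t - φ 0) / t - D * t
  have hψ : ∀ t ∈ Ioc (0 : ℝ) 1,
      HasDerivAt ψ ((φ' t * t - (φ t - φ 0) * 1) / t ^ 2 - D * 1) t := fun t ht =>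
    (((hφ t).sub_const _).div (hasDerivAt_id t) ht.1.ne').sub ((hasDerivAt_id t).const_mul D)
  have hmono : MonotoneOn ψ (Ioc 0 1) := by
    refine monotoneOn_of_deriv_nonneg (convex_Ioc 0 1)
      (fun t ht => (hψ t ht).continuousAt.continuousWithinAt)
      (fun t ht => (hψ t (interior_subset ht)).differentiableAt.differentiableWithinAt) ?_
    intro t ht
    have ht' := interior_subset ht
    have ht₀ : 0 < t := ht'.1
    rw [(hψ t ht').deriv, sub_nonneg, le_div_iff₀ (by positivity)]
    linarith [h t ht']
  have hlim : Filter.Tendsto ψ (nhdsWithin 0 (Ioi 0)) (nhds (φ' 0)) := by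
    have h₁ := (hφ 0).tendsto_slope_zero_right
    have h₂ : Filter.Tendsto (fun t : ℝ => D * t) (nhdsWithin 0 (Ioi 0)) (nhds (D * 0)) :=
      ((continuous_const_mul D).tendsto 0).mono_left nhdsWithin_le_nhds
    have h₃ := h₁.sub h₂
    rw [mul_zero, sub_zero] at h₃
    refine h₃.congr fun t => ?_
    simp only [ψ, zero_add, smul_eq_mul, div_eq_inv_mul]
  have hle : φ' 0 ≤ ψ 1 := by
    refine le_of_tendsto hlim ?_
    filter_upwards [Ioc_mem_nhdsGT (zero_lt_one' ℝ)] with t ht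
    exact hmono ht ⟨zero_lt_one, le_rfl⟩ ht.2
  simp only [ψ, div_one, mul_one] at hle
  linarith

/-- Quasi-strong convexity implies the quadratic under-approximation property
(Theorem 1 / `th_qap=wsc`). -/
theorem quasi_strong_convex_implies_quadratic_under_approximation
    {n : ℕ} (X Xstar : Set (EuclideanSpace ℝ (Fin n)))
    (f : EuclideanSpace ℝ (Fin n) → ℝ)
    (f' proj : EuclideanSpace ℝ (Fin n) → EuclideanSpace ℝ (Fin n))
    (fstar κ : ℝ)
    -- X is a nonempty closed convex set
    (hXne : X.Nonempty) (hXclosed : IsClosed X) (hXconv : Convex ℝ X)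
    -- f is convex and continuously differentiable, with gradient f'
    (hconv : ConvexOn ℝ univ f)
    (hsmooth : ContDiff ℝ 1 f)
    (hgrad : ∀ x, HasGradientAt f (f' x) x)
    -- Xstar is the (nonempty, closed) set of minimizers of f over X, with optimal value fstar
    (hXstar : Xstar = {x ∈ X | ∀ y ∈ X, f x ≤ f y})
    (hXstar_ne : Xstar.Nonempty) (hXstar_closed : IsClosed Xstar)
    (hfstar : ∀ x ∈ Xstar, f x = fstar)
    -- proj is the Euclidean projection onto Xstar
    (hproj : ∀ x, proj x ∈ Xstar ∧ ∀ y ∈ Xstar, ‖x - proj x‖ ≤ ‖x - y‖)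
    -- f is quasi-strongly convex on X with constant κ > 0
    (hκ : 0 < κ)
    (hqsc : ∀ x ∈ X, fstar ≥ f x + ⟪f' x, proj x - x⟫_ℝ + κ / 2 * ‖x - proj x‖ ^ 2) :
    -- then f has quadratic under-approximation on X with the same constant κ
    ∀ x ∈ X, f x ≥ fstar + ⟪f' (proj x), x - proj x⟫_ℝ + κ / 2 * ‖x - proj x‖ ^ 2 := by
  intro x hx
  have hXstar_conv : Convex ℝ Xstar := by
    rw [hXstar]
    intro a ha b hb s t hs ht hst
    refine ⟨hXconv ha.1 hb.1 hs ht hst, fun y hy => ?_⟩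
    have h₁ := hconv.2 (mem_univ a) (mem_univ b) hs ht hst
    simp only [smul_eq_mul] at h₁
    calc f (s • a + t • b) ≤ s * f a + t * f b := h₁
      _ ≤ s * f y + t * f y := by gcongr; exacts [ha.2 y hy, hb.2 y hy]
      _ = f y := by rw [← add_mul, hst, one_mul]
  obtain ⟨hp, hxp⟩ := hproj x
  set p := proj x
  have hpX : p ∈ X := by
    have h₁ := hp
    rw [hXstar] at h₁
    exact h₁.1
  have hderiv : ∀ t : ℝ,
      HasDerivAt (fun t : ℝ => f (p + t • (x - p))) ⟪f' (p + t • (x - p)), x - p⟫_ℝ t := by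
    intro t
    have hline : HasDerivAt (fun t : ℝ => p + t • (x - p)) (x - p) t := by
      simpa using ((hasDerivAt_id t).smul_const (x - p)).const_add p
    have hcomp := (hgrad (p + t • (x - p))).hasFDerivAt.comp_hasDerivAt t hline
    rw [InnerProductSpace.toDual_apply_apply] at hcomp
    exact hcomp
  have key := add_deriv_zero_add_le_of_sub_add_le_mul_deriv
    (D := κ / 2 * ‖x - p‖ ^ 2) hderiv ?_
  · simpa [hfstar p hp] using key
  · intro t ht
    have hproj_eq : proj (p + t • (x - p)) = p :=
      eq_of_forall_norm_sub_le_of_mem_segment hXstar_conv ht.1.le hp hxp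
        (hproj _).1 (hproj _).2
    have hq := hqsc _ (hXconv.add_smul_sub_mem hpX hx ⟨ht.1.le, ht.2⟩)
    rw [hproj_eq, sub_add_cancel_left, add_sub_cancel_left, inner_neg_right,
      real_inner_smul_right, norm_smul, mul_pow, Real.norm_eq_abs, sq_abs] at hq
    simp only [zero_smul, add_zero, hfstar p hp]
    linarith
end

section
/- If a convex, continuously differentiable function f is quasi-strongly convex on X with constant κ_f > 0, then f has quadratic gradient growth on X with the same constant κ_f, i.e., ⟨∇f(x) − ∇f(x̄), x − x̄⟩ ≥ κ_f‖x − x̄‖² for all x ∈ X. -/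
open Set
open scoped InnerProductSpace

/-- A real function whose derivative satisfies the one-dimensional quasi-strong convexity inequality
on `(0, 1]` lies above its tangent at `0` by the quadratic term at `1`. -/
theorem le_sub_sub_deriv_of_quasi_strong {g g' : ℝ → ℝ} {c : ℝ}
    (hg : ∀ t, HasDerivAt g (g' t) t)
    (h : ∀ t ∈ Ioc (0 : ℝ) 1, g t - t * g' t + c * t ^ 2 ≤ g 0) :
    c ≤ g 1 - g 0 - g' 0 := by
  have hd : ∀ t : ℝ, 0 < t → HasDerivAt (fun t => (g t - g 0) / t - c * t)
      ((g' t * t - (g t - g 0) * 1) / t ^ 2 - c * 1) t := fun t ht =>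
    (((hg t).sub_const (g 0)).div (hasDerivAt_id t) ht.ne').sub ((hasDerivAt_id t).const_mul c)
  have hmono : MonotoneOn (fun t => (g t - g 0) / t - c * t) (Ioc 0 1) := by
    apply monotoneOn_of_deriv_nonneg (convex_Ioc 0 1)
    · exact fun t ht => (hd t ht.1).continuousAt.continuousWithinAt
    · intro t ht
      rw [interior_Ioc] at ht
      exact (hd t ht.1).differentiableAt.differentiableWithinAt
    · intro t ht
      rw [interior_Ioc] at ht
      rw [(hd t ht.1).deriv, sub_nonneg, le_div_iff₀ (pow_pos ht.1 2)]
      linarith [h t ⟨ht.1, ht.2.le⟩]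
  have hlim : Filter.Tendsto (fun t => (g t - g 0) / t - c * t) (nhdsWithin 0 (Ioi 0))
      (nhds (g' 0 - c * 0)) := by
    refine Filter.Tendsto.sub ?_ ?_
    · refine ((hasDerivAt_iff_tendsto_slope.1 (hg 0)).mono_left
        (nhdsWithin_mono 0 fun t ht => (ne_of_gt ht : t ≠ 0))).congr fun t => ?_
      rw [slope_def_field, sub_zero]
    · exact ((continuous_const.mul continuous_id).tendsto 0).mono_left nhdsWithin_le_nhds
  have hle : g' 0 - c * 0 ≤ (g 1 - g 0) / 1 - c * 1 := by
    refine le_of_tendsto hlim ?_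
    filter_upwards [Ioc_mem_nhdsGT (zero_lt_one' ℝ)] with t ht
    exact hmono ht ⟨zero_lt_one, le_rfl⟩ ht.2
  linarith

/-- Points of a convex set at minimal distance from a given point coincide. -/
theorem Convex.eq_of_norm_sub_le {E : Type*} [NormedAddCommGroup E] [InnerProductSpace ℝ E]
    {S : Set E} (hS : Convex ℝ S) {x p q : E} (hp : p ∈ S) (hq : q ∈ S)
    (hmin : ∀ y ∈ S, ‖x - p‖ ≤ ‖x - y‖) (hle : ‖x - q‖ ≤ ‖x - p‖) : q = p := by
  have hm := hmin _ (hS hp hq (by norm_num : (0 : ℝ) ≤ 1 / 2) (by norm_num : (0 : ℝ) ≤ 1 / 2)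
    (by norm_num))
  have hpar := parallelogram_law_with_norm ℝ (x - p) (x - q)
  have hsum : (x - p) + (x - q) = (2 : ℝ) • (x - ((1 / 2 : ℝ) • p + (1 / 2 : ℝ) • q)) := by
    module
  have hdiff : (x - p) - (x - q) = q - p := by abel
  rw [hsum, hdiff, norm_smul, Real.norm_of_nonneg zero_le_two] at hpar
  have hzero : ‖q - p‖ = 0 := by
    nlinarith [norm_nonneg (q - p), norm_nonneg (x - p), norm_nonneg (x - q)]
  exact sub_eq_zero.1 (norm_eq_zero.1 hzero)

/-- If `p` is the nearest point to `x` in a convex set, then it is also the nearest point, in that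
set, to every point of the segment joining `p` and `x`. -/
theorem Convex.eq_of_norm_sub_le_of_segment {E : Type*} [NormedAddCommGroup E]
    [InnerProductSpace ℝ E] {S : Set E} (hS : Convex ℝ S) {x p q : E} (hp : p ∈ S) (hq : q ∈ S)
    (hmin : ∀ y ∈ S, ‖x - p‖ ≤ ‖x - y‖) {t : ℝ} (ht0 : 0 ≤ t) (ht1 : t ≤ 1)
    (hle : ‖p + t • (x - p) - q‖ ≤ ‖p + t • (x - p) - p‖) : q = p := by
  refine hS.eq_of_norm_sub_le hp hq hmin ?_
  have hx : x - q = (1 - t) • (x - p) + (p + t • (x - p) - q) := by module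
  rw [add_sub_cancel_left, norm_smul, Real.norm_of_nonneg ht0] at hle
  calc ‖x - q‖ ≤ ‖(1 - t) • (x - p)‖ + ‖p + t • (x - p) - q‖ := hx ▸ norm_add_le _ _
    _ ≤ (1 - t) * ‖x - p‖ + t * ‖x - p‖ := by
      rw [norm_smul, Real.norm_of_nonneg (sub_nonneg.2 ht1)]
      gcongr
    _ = ‖x - p‖ := by ring

/-- Quasi-strong convexity implies quadratic gradient growth with the same constant (Theorem 2 / `th_var=wsc`). -/
theorem quasi_strong_convex_implies_quadratic_gradient_growth
    {n : ℕ} (X Xstar : Set (EuclideanSpace ℝ (Fin n)))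
    (f : EuclideanSpace ℝ (Fin n) → ℝ)
    (f' proj : EuclideanSpace ℝ (Fin n) → EuclideanSpace ℝ (Fin n))
    (fstar κ : ℝ)
    -- X is a nonempty closed convex set
    (hXne : X.Nonempty) (hXclosed : IsClosed X) (hXconv : Convex ℝ X)
    -- f is convex and continuously differentiable, with gradient f'
    (hconv : ConvexOn ℝ univ f)
    (hsmooth : ContDiff ℝ 1 f)
    (hgrad : ∀ x, HasGradientAt f (f' x) x)
    -- Xstar is the (nonempty, closed) set of minimizers of f over X, with optimal value fstar
    (hXstar : Xstar = {x ∈ X | ∀ y ∈ X, f x ≤ f y})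
    (hXstar_ne : Xstar.Nonempty) (hXstar_closed : IsClosed Xstar)
    (hfstar : ∀ x ∈ Xstar, f x = fstar)
    -- proj is the Euclidean projection onto Xstar
    (hproj : ∀ x, proj x ∈ Xstar ∧ ∀ y ∈ Xstar, ‖x - proj x‖ ≤ ‖x - y‖)
    (hκ : 0 < κ)
    -- hypothesis
    (hqsc : ∀ x ∈ X, fstar ≥ f x + ⟪f' x, proj x - x⟫_ℝ + κ / 2 * ‖x - proj x‖ ^ 2) :
    -- conclusion
    ∀ x ∈ X, ⟪f' x - f' (proj x), x - proj x⟫_ℝ ≥ κ * ‖x - proj x‖ ^ 2 := by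
  intro x hx
  obtain ⟨hp, hmin⟩ := hproj x
  set p := proj x with hpdef
  have hsub : Xstar ⊆ X := by
    rw [hXstar]
    exact fun y hy => hy.1
  have hSconv : Convex ℝ Xstar := by
    have hlevel : Xstar = {y ∈ X | f y ≤ fstar} := by
      ext y
      refine ⟨fun hy => ⟨hsub hy, (hfstar y hy).le⟩, fun hy => ?_⟩
      rw [hXstar] at hp ⊢
      refine ⟨hy.1, fun z hz => hy.2.trans ?_⟩
      rw [← hfstar p (hXstar ▸ hp)]
      exact hp.2 z hz
    rw [hlevel]
    exact (hconv.subset (subset_univ X) hXconv).convex_le fstar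
  have hderiv : ∀ t : ℝ, HasDerivAt (fun t : ℝ => f (p + t • (x - p)))
      ⟪f' (p + t • (x - p)), x - p⟫_ℝ t := by
    intro t
    have hline : HasDerivAt (fun t : ℝ => p + t • (x - p)) (x - p) t := by
      simpa using ((hasDerivAt_id t).smul_const (x - p)).const_add p
    exact (hgrad (p + t • (x - p))).hasFDerivAt.comp_hasDerivAt t hline
  have hgap := le_sub_sub_deriv_of_quasi_strong (c := κ / 2 * ‖x - p‖ ^ 2) hderiv (by
    intro t ht
    have hmem : p + t • (x - p) ∈ X :=
      hXconv.add_smul_sub_mem (hsub hp) hx ⟨ht.1.le, ht.2⟩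
    have hprojt : proj (p + t • (x - p)) = p :=
      hSconv.eq_of_norm_sub_le_of_segment hp (hproj _).1 hmin ht.1.le ht.2 ((hproj _).2 p hp)
    have hq := hqsc _ hmem
    have hback : p - (p + t • (x - p)) = -(t • (x - p)) := by abel
    rw [hprojt, hback, add_sub_cancel_left, inner_neg_right, real_inner_smul_right, norm_smul,
      Real.norm_of_nonneg ht.1.le] at hq
    rw [zero_smul, add_zero, hfstar p hp]
    linarith)
  have hq := hqsc x hx
  rw [← hpdef, ← neg_sub x p, inner_neg_right] at hq
  rw [one_smul, zero_smul, add_zero, add_sub_cancel, hfstar p hp] at hgap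
  rw [inner_sub_left]
  linarith
end

section
/- If a convex, continuously differentiable function f has a quadratic under-approximation on X with constant κ_f > 0, then f has quadratic gradient growth on X with constant κ_f/2, i.e., ⟨∇f(x) − ∇f(x̄), x − x̄⟩ ≥ (κ_f/2)‖x − x̄‖² for all x ∈ X. -/
open Set
open scoped InnerProductSpace

/-- First-order condition: a convex function lies above its tangent hyperplanes. -/
theorem ConvexOn.add_inner_gradient_le {E : Type*} [NormedAddCommGroup E]
    [InnerProductSpace ℝ E] [CompleteSpace E] {f : E → ℝ} {g x : E}
    (hf : ConvexOn ℝ univ f) (hg : HasGradientAt f g x) (y : E) :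
    f x + ⟪g, y - x⟫_ℝ ≤ f y := by
  have hline : ConvexOn ℝ univ (f ∘ AffineMap.lineMap (k := ℝ) x y) :=
    hf.comp_affineMap (AffineMap.lineMap x y)
  have hderiv : HasDerivAt (f ∘ AffineMap.lineMap (k := ℝ) x y) ⟪g, y - x⟫_ℝ 0 := by
    have h := hg.hasFDerivAt
    rw [← AffineMap.lineMap_apply_zero (k := ℝ) x y] at h
    simpa using h.comp_hasDerivAt (0 : ℝ) AffineMap.hasDerivAt_lineMap
  have h := hline.le_slope_of_hasDerivAt (mem_univ 0) (mem_univ 1) one_pos hderiv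
  simp [slope_def_field] at h
  linarith

/-- The quadratic under-approximation property implies quadratic gradient growth with constant κ/2. -/
theorem quadratic_under_approximation_implies_quadratic_gradient_growth_half
    {n : ℕ} (X Xstar : Set (EuclideanSpace ℝ (Fin n)))
    (f : EuclideanSpace ℝ (Fin n) → ℝ)
    (f' proj : EuclideanSpace ℝ (Fin n) → EuclideanSpace ℝ (Fin n))
    (fstar κ : ℝ)
    -- X is a nonempty closed convex set
    (hXne : X.Nonempty) (hXclosed : IsClosed X) (hXconv : Convex ℝ X)
    -- f is convex and continuously differentiable, with gradient f'
    (hconv : ConvexOn ℝ univ f)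
    (hsmooth : ContDiff ℝ 1 f)
    (hgrad : ∀ x, HasGradientAt f (f' x) x)
    -- Xstar is the (nonempty, closed) set of minimizers of f over X, with optimal value fstar
    (hXstar : Xstar = {x ∈ X | ∀ y ∈ X, f x ≤ f y})
    (hXstar_ne : Xstar.Nonempty) (hXstar_closed : IsClosed Xstar)
    (hfstar : ∀ x ∈ Xstar, f x = fstar)
    -- proj is the Euclidean projection onto Xstar
    (hproj : ∀ x, proj x ∈ Xstar ∧ ∀ y ∈ Xstar, ‖x - proj x‖ ≤ ‖x - y‖)
    (hκ : 0 < κ)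
    -- hypothesis
    (hua : ∀ x ∈ X, f x ≥ fstar + ⟪f' (proj x), x - proj x⟫_ℝ + κ / 2 * ‖x - proj x‖ ^ 2) :
    -- conclusion
    ∀ x ∈ X, ⟪f' x - f' (proj x), x - proj x⟫_ℝ ≥ κ / 2 * ‖x - proj x‖ ^ 2 := by
  intro x hx
  have htangent := hconv.add_inner_gradient_le (hgrad x) (proj x)
  rw [hfstar _ (hproj x).1, ← neg_sub x (proj x), inner_neg_right] at htangent
  rw [inner_sub_left]
  linarith [hua x hx]
end

section
/- If a convex, continuously differentiable function f has quadratic gradient growth on X with constant κ_f > 0, then f has a quadratic under-approximation on X with the same constant κ_f, i.e., f(x) ≥ f* + ⟨∇f(x̄), x − x̄⟩ + (κ_f/2)‖x − x̄‖² for all x ∈ X. -/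
open Set
open scoped InnerProductSpace

/-- A nearest point of `S` to `x` is the only nearest point of `S` to any point strictly between. -/
lemma eq_of_nearest_on_segment {E : Type*} [NormedAddCommGroup E] [InnerProductSpace ℝ E]
    {x p q : E} {t : ℝ} (ht : t < 1) (ht0 : 0 ≤ t) (hx : ‖x - p‖ ≤ ‖x - q‖)
    (hy : ‖p + t • (x - p) - q‖ ≤ ‖p + t • (x - p) - p‖) : q = p := by
  have e1 : x - q = (x - p) + (p - q) := by abel
  have e2 : p + t • (x - p) - q = t • (x - p) + (p - q) := by abel
  have h1 := pow_le_pow_left₀ (norm_nonneg _) hx 2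
  have h2 := pow_le_pow_left₀ (norm_nonneg _) hy 2
  rw [e1, norm_add_sq_real] at h1
  rw [e2, add_sub_cancel_left, norm_add_sq_real, real_inner_smul_left] at h2
  have h3 : ‖p - q‖ ^ 2 ≤ 0 := by
    nlinarith [sq_nonneg ‖p - q‖, mul_le_mul_of_nonneg_left h1 ht0]
  have h4 : ‖p - q‖ = 0 := by nlinarith [norm_nonneg (p - q)]
  exact (sub_eq_zero.1 (norm_eq_zero.1 h4)).symm

/-- If the gradient of `f` grows at least linearly with slope `κ` along the segment from `p` to
`x`, then `f x` dominates the corresponding quadratic model at `p`. -/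
lemma quadratic_lower_bound_of_inner_gradient_growth {E : Type*} [NormedAddCommGroup E]
    [InnerProductSpace ℝ E] [CompleteSpace E] {f : E → ℝ} {f' : E → E} {p v : E} {κ : ℝ}
    (hgrad : ∀ x, HasGradientAt f (f' x) x)
    (hgrowth : ∀ t ∈ Ioo (0 : ℝ) 1, κ * t * ‖v‖ ^ 2 ≤ ⟪f' (p + t • v) - f' p, v⟫_ℝ) :
    f p + ⟪f' p, v⟫_ℝ + κ / 2 * ‖v‖ ^ 2 ≤ f (p + v) := by
  let φ : ℝ → ℝ := fun t => f (p + t • v) - t * ⟪f' p, v⟫_ℝ - t ^ 2 * (κ / 2 * ‖v‖ ^ 2)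
  have hφ (t : ℝ) : HasDerivAt φ (⟪f' (p + t • v) - f' p, v⟫_ℝ - κ * t * ‖v‖ ^ 2) t := by
    have hline : HasDerivAt (fun s : ℝ => p + s • v) v t := by
      simpa using ((hasDerivAt_id t).smul_const v).const_add p
    have hf := (hgrad (p + t • v)).hasFDerivAt.comp_hasDerivAt t hline
    refine ((hf.sub ((hasDerivAt_id t).mul_const _)).sub
      ((hasDerivAt_pow 2 t).mul_const (κ / 2 * ‖v‖ ^ 2))).congr_deriv ?_
    simp only [InnerProductSpace.toDual_apply_apply, inner_sub_left]
    ring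
  have hmono : MonotoneOn φ (Icc 0 1) := by
    refine monotoneOn_of_deriv_nonneg (convex_Icc 0 1)
      (fun t _ => (hφ t).continuousAt.continuousWithinAt)
      (fun t _ => (hφ t).differentiableAt.differentiableWithinAt) fun t ht => ?_
    rw [interior_Icc] at ht
    rw [(hφ t).deriv]
    exact sub_nonneg.2 (hgrowth t ht)
  have h := hmono (left_mem_Icc.2 zero_le_one) (right_mem_Icc.2 zero_le_one) zero_le_one
  simp only [φ, zero_smul, one_smul, add_zero] at h
  linarith

/-- Quadratic gradient growth implies the quadratic under-approximation property with the same constant (Theorem 3 / `th_qap=var`). -/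
theorem quadratic_gradient_growth_implies_quadratic_under_approximation
    {n : ℕ} (X Xstar : Set (EuclideanSpace ℝ (Fin n)))
    (f : EuclideanSpace ℝ (Fin n) → ℝ)
    (f' proj : EuclideanSpace ℝ (Fin n) → EuclideanSpace ℝ (Fin n))
    (fstar κ : ℝ)
    -- X is a nonempty closed convex set
    (hXne : X.Nonempty) (hXclosed : IsClosed X) (hXconv : Convex ℝ X)
    -- f is convex and continuously differentiable, with gradient f'
    (hconv : ConvexOn ℝ univ f)
    (hsmooth : ContDiff ℝ 1 f)
    (hgrad : ∀ x, HasGradientAt f (f' x) x)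
    -- Xstar is the (nonempty, closed) set of minimizers of f over X, with optimal value fstar
    (hXstar : Xstar = {x ∈ X | ∀ y ∈ X, f x ≤ f y})
    (hXstar_ne : Xstar.Nonempty) (hXstar_closed : IsClosed Xstar)
    (hfstar : ∀ x ∈ Xstar, f x = fstar)
    -- proj is the Euclidean projection onto Xstar
    (hproj : ∀ x, proj x ∈ Xstar ∧ ∀ y ∈ Xstar, ‖x - proj x‖ ≤ ‖x - y‖)
    (hκ : 0 < κ)
    -- hypothesis
    (hgg : ∀ x ∈ X, ⟪f' x - f' (proj x), x - proj x⟫_ℝ ≥ κ * ‖x - proj x‖ ^ 2) :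
    -- conclusion
    ∀ x ∈ X, f x ≥ fstar + ⟪f' (proj x), x - proj x⟫_ℝ + κ / 2 * ‖x - proj x‖ ^ 2 := by
  intro x hx
  have hpX : proj x ∈ X := by
    have := (hproj x).1
    rw [hXstar] at this
    exact this.1
  have key := quadratic_lower_bound_of_inner_gradient_growth (p := proj x) (v := x - proj x)
    (κ := κ) hgrad fun t ht => by
      have hyX : proj x + t • (x - proj x) ∈ X :=
        hXconv.add_smul_sub_mem hpX hx ⟨ht.1.le, ht.2.le⟩
      have hq : proj (proj x + t • (x - proj x)) = proj x :=
        eq_of_nearest_on_segment ht.2 ht.1.le ((hproj x).2 _ (hproj _).1)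
          ((hproj _).2 _ (hproj x).1)
      have h := hgg _ hyX
      rw [hq, add_sub_cancel_left, real_inner_smul_right, norm_smul, mul_pow, Real.norm_eq_abs,
        sq_abs] at h
      refine le_of_mul_le_mul_left ?_ ht.1
      linarith
  rwa [add_sub_cancel, hfstar _ (hproj x).1] at key
end

section
/- Let f be a convex function with L_f-Lipschitz continuous gradient on X. If there exists a constant β ∈ (0,1) such that ‖x⁺ − [x⁺]_{X*}‖ ≤ β‖x − [x]_{X*}‖ for all x ∈ X, where x⁺ = [x − (1/L_f)∇f(x)]_X is the projected gradient step from x, then f satisfies the quadratic functional growth condition on X with constant κ_f = L_f(1 − β)², i.e., f(x) − f* ≥ (L_f(1 − β)²/2)‖x − [x]_{X*}‖² for all x ∈ X. -/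
open Set
open scoped InnerProductSpace

section ProjectedGradient

variable {E : Type*} [NormedAddCommGroup E] [InnerProductSpace ℝ E]

/-- The variational inequality for a nearest point of a convex set. -/
lemma Convex.inner_sub_le_zero_of_forall_norm_sub_le {K : Set E} (hK : Convex ℝ K) {u p : E}
    (hp : p ∈ K) (hmin : ∀ y ∈ K, ‖u - p‖ ≤ ‖u - y‖) {y : E} (hy : y ∈ K) :
    ⟪u - p, y - p⟫_ℝ ≤ 0 := by
  refine (norm_eq_iInf_iff_real_inner_le_zero hK hp).1 ?_ y hy
  have : Nonempty K := ⟨⟨p, hp⟩⟩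
  exact le_antisymm (le_ciInf fun w => hmin w w.2)
    (ciInf_le (f := fun w : K => ‖u - w‖) ⟨0, by rintro _ ⟨w, rfl⟩; positivity⟩ ⟨p, hp⟩)

/-- The descent lemma: the quadratic upper bound for a function whose gradient is Lipschitz
continuous on a convex set. -/
lemma Convex.le_add_inner_add_sq_of_lipschitz_gradient [CompleteSpace E] {K : Set E}
    (hK : Convex ℝ K) {f : E → ℝ} {f' : E → E} {L : ℝ}
    (hgrad : ∀ x, HasGradientAt f (f' x) x)
    (hLip : ∀ x ∈ K, ∀ y ∈ K, ‖f' x - f' y‖ ≤ L * ‖x - y‖)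
    {x y : E} (hx : x ∈ K) (hy : y ∈ K) :
    f y ≤ f x + ⟪f' x, y - x⟫_ℝ + L / 2 * ‖y - x‖ ^ 2 := by
  set v := y - x with hv
  let φ : ℝ → ℝ := fun t => f (x + t • v) - (t * ⟪f' x, v⟫_ℝ + t ^ 2 * (L / 2 * ‖v‖ ^ 2))
  have hφ : ∀ t, HasDerivAt φ
      (⟪f' (x + t • v), v⟫_ℝ - (1 * ⟪f' x, v⟫_ℝ + 2 * t * (L / 2 * ‖v‖ ^ 2))) t := by
    intro t
    have hline : HasDerivAt (fun s : ℝ => x + s • v) v t := by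
      simpa using ((hasDerivAt_id t).smul_const v).const_add x
    have hf : HasDerivAt (fun s : ℝ => f (x + s • v)) ⟪f' (x + t • v), v⟫_ℝ t := by
      simpa [Function.comp_def] using (hgrad (x + t • v)).hasFDerivAt.comp_hasDerivAt t hline
    have hsq : HasDerivAt (fun s : ℝ => s ^ 2) (2 * t) t := by
      simpa using hasDerivAt_pow 2 t
    exact hf.sub (((hasDerivAt_id t).mul_const _).add (hsq.mul_const _))
  have hanti : AntitoneOn φ (Icc 0 1) := by
    refine antitoneOn_of_deriv_nonpos (convex_Icc 0 1)
      (fun t _ => (hφ t).continuousAt.continuousWithinAt)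
      (fun t _ => (hφ t).differentiableAt.differentiableWithinAt) fun t ht => ?_
    rw [interior_Icc] at ht
    rw [(hφ t).deriv]
    have hmem : x + t • v ∈ K := hK.add_smul_sub_mem hx hy ⟨ht.1.le, ht.2.le⟩
    have hbound : ⟪f' (x + t • v) - f' x, v⟫_ℝ ≤ L * (t * ‖v‖) * ‖v‖ := by
      refine (real_inner_le_norm _ _).trans (mul_le_mul_of_nonneg_right ?_ (norm_nonneg v))
      simpa [norm_smul, abs_of_pos ht.1] using hLip _ hmem x hx
    rw [inner_sub_left] at hbound
    linarith
  have h := hanti (left_mem_Icc.2 zero_le_one) (right_mem_Icc.2 zero_le_one) zero_le_one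
  simp only [φ, hv, one_smul, zero_smul, add_sub_cancel, add_zero] at h
  linarith

/-- Sufficient decrease of the projected gradient step with step size `1 / L`. -/
lemma Convex.sq_norm_sub_le_of_projected_gradient_step [CompleteSpace E] {K : Set E}
    (hK : Convex ℝ K) {f : E → ℝ} {f' : E → E} {L : ℝ} (hL : 0 < L)
    (hgrad : ∀ x, HasGradientAt f (f' x) x)
    (hLip : ∀ x ∈ K, ∀ y ∈ K, ‖f' x - f' y‖ ≤ L * ‖x - y‖)
    {x p : E} (hx : x ∈ K) (hp : p ∈ K)
    (hmin : ∀ y ∈ K, ‖x - (1 / L) • f' x - p‖ ≤ ‖x - (1 / L) • f' x - y‖) :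
    L / 2 * ‖x - p‖ ^ 2 ≤ f x - f p := by
  have hdesc := hK.le_add_inner_add_sq_of_lipschitz_gradient hgrad hLip hx hp
  have hvar := hK.inner_sub_le_zero_of_forall_norm_sub_le hp hmin hx
  rw [sub_right_comm, inner_sub_left, real_inner_self_eq_norm_sq, real_inner_smul_left] at hvar
  have hvar' : L * ‖x - p‖ ^ 2 ≤ ⟪f' x, x - p⟫_ℝ := by
    have h := mul_nonpos_of_nonneg_of_nonpos hL.le hvar
    field_simp at h
    linarith
  rw [← neg_sub x p, inner_neg_right, norm_neg] at hdesc
  linarith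

end ProjectedGradient

/-- If the projected gradient step contracts the distance to the optimal set by a factor
β < 1, then f satisfies the quadratic functional growth condition with constant Lf(1-β)²
(Theorem 5 / `th_necesary_linconv`). -/
theorem contraction_implies_quadratic_functional_growth
    {n : ℕ} (X Xstar : Set (EuclideanSpace ℝ (Fin n)))
    (f : EuclideanSpace ℝ (Fin n) → ℝ)
    (f' proj projX : EuclideanSpace ℝ (Fin n) → EuclideanSpace ℝ (Fin n))
    (fstar Lf : ℝ)
    -- X is a nonempty closed convex set
    (hXne : X.Nonempty) (hXclosed : IsClosed X) (hXconv : Convex ℝ X)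
    -- f is convex and continuously differentiable, with gradient f'
    (hconv : ConvexOn ℝ univ f)
    (hsmooth : ContDiff ℝ 1 f)
    (hgrad : ∀ x, HasGradientAt f (f' x) x)
    -- the gradient of f is Lipschitz continuous on X with constant Lf > 0
    (hLf : 0 < Lf)
    (hLip : ∀ x ∈ X, ∀ y ∈ X, ‖f' x - f' y‖ ≤ Lf * ‖x - y‖)
    -- Xstar is the (nonempty, closed) set of minimizers of f over X, with optimal value fstar
    (hXstar : Xstar = {x ∈ X | ∀ y ∈ X, f x ≤ f y})
    (hXstar_ne : Xstar.Nonempty) (hXstar_closed : IsClosed Xstar)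
    (hfstar : ∀ x ∈ Xstar, f x = fstar)
    -- proj is the Euclidean projection onto Xstar
    (hproj : ∀ x, proj x ∈ Xstar ∧ ∀ y ∈ Xstar, ‖x - proj x‖ ≤ ‖x - y‖)
    -- projX is the Euclidean projection onto X
    (hprojX : ∀ u, projX u ∈ X ∧ ∀ y ∈ X, ‖u - projX u‖ ≤ ‖u - y‖)
    -- contraction hypothesis for the projected gradient step x⁺ = [x - (1/Lf)∇f(x)]_X
    (β : ℝ) (hβ0 : 0 < β) (hβ1 : β < 1)
    (hcontr : ∀ x ∈ X,
      ‖projX (x - (1 / Lf) • f' x) - proj (projX (x - (1 / Lf) • f' x))‖ ≤ β * ‖x - proj x‖) :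
    -- conclusion: quadratic functional growth with constant Lf(1-β)²
    ∀ x ∈ X, f x - fstar ≥ Lf * (1 - β) ^ 2 / 2 * ‖x - proj x‖ ^ 2 := by
  intro x hx
  obtain ⟨hp, hmin⟩ := hprojX (x - (1 / Lf) • f' x)
  have hc := hcontr x hx
  set p := projX (x - (1 / Lf) • f' x)
  have hdec := hXconv.sq_norm_sub_le_of_projected_gradient_step hLf hgrad hLip hx hp hmin
  have hfp : fstar ≤ f p := by
    have hmem := (hproj x).1
    rw [← hfstar _ hmem]
    rw [hXstar] at hmem
    exact hmem.2 p hp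
  have hdist : (1 - β) * ‖x - proj x‖ ≤ ‖x - p‖ := by
    have h := (hproj x).2 _ (hproj p).1
    have htri := norm_sub_le_norm_sub_add_norm_sub x p (proj p)
    linarith
  have hsq : ((1 - β) * ‖x - proj x‖) ^ 2 ≤ ‖x - p‖ ^ 2 :=
    pow_le_pow_left₀ (mul_nonneg (sub_nonneg.2 hβ1.le) (norm_nonneg _)) hdist 2
  have := mul_le_mul_of_nonneg_left hsq (half_pos hLf).le
  rw [mul_pow] at this
  linarith
end

section
/- Let X ⊆ ℝ^n be a nonempty closed convex set, A ∈ ℝ^{m×n} a nonzero matrix, and g : ℝ^m → ℝ a σ_g-strongly convex function with L_g-Lipschitz continuous gradient. Set f(x) = g(Ax) and assume f attains its minimum f* on X with nonempty closed optimal set X*. Then: (i) f has Lipschitz continuous gradient with constant L_f = L_g‖A‖² (spectral norm); and (ii) if θ > 0 is a constant such that ‖x − x̄‖ ≤ θ‖Ax − Ax̄‖ for all x ∈ X (where x̄ = [x]_{X*}), then f is quasi-strongly convex on X with constant κ_f = σ_g/θ², i.e., f* ≥ f(x) + ⟨∇f(x), x̄ − x⟩ + (σ_g/(2θ²))‖x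 − x̄‖² for all x ∈ X. -/
open Set
open scoped InnerProductSpace

/-- Chain rule for the gradient of a function precomposed with a continuous linear map. -/
theorem HasGradientAt.comp_continuousLinearMap {E F : Type*}
    [NormedAddCommGroup E] [InnerProductSpace ℝ E] [CompleteSpace E]
    [NormedAddCommGroup F] [InnerProductSpace ℝ F] [CompleteSpace F]
    {g : F → ℝ} {v : F} (A : E →L[ℝ] F) {x : E} (hg : HasGradientAt g v (A x)) :
    HasGradientAt (g ∘ A) (ContinuousLinearMap.adjoint A v) x := by
  rw [hasGradientAt_iff_hasFDerivAt] at hg ⊢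
  refine (hg.comp x A.hasFDerivAt).congr_fderiv ?_
  ext w
  simp [ContinuousLinearMap.adjoint_inner_left]

/-- A function whose gradient is strongly monotone lies above its quadratic lower models. -/
theorem add_inner_add_sq_le_of_strongly_monotone_gradient {F : Type*}
    [NormedAddCommGroup F] [InnerProductSpace ℝ F] [CompleteSpace F]
    {g : F → ℝ} {g' : F → F} {σ : ℝ} (hg : ∀ u, HasGradientAt g (g' u) u)
    (hmono : ∀ u v, σ * ‖u - v‖ ^ 2 ≤ ⟪g' u - g' v, u - v⟫_ℝ) (u v : F) :
    g u + ⟪g' u, v - u⟫_ℝ + σ / 2 * ‖v - u‖ ^ 2 ≤ g v := by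
  set d := v - u with hd
  let φ : ℝ → ℝ := fun t => g (u + t • d) - t * ⟪g' u, d⟫_ℝ - σ / 2 * ‖d‖ ^ 2 * t ^ 2
  have hφ (t : ℝ) :
      HasDerivAt φ (⟪g' (u + t • d) - g' u, d⟫_ℝ - σ * ‖d‖ ^ 2 * t) t := by
    have hline : HasDerivAt (fun s : ℝ => u + s • d) d t := by
      simpa using ((hasDerivAt_id t).smul_const d).const_add u
    have hcomp : HasDerivAt (fun s : ℝ => g (u + s • d)) ⟪g' (u + t • d), d⟫_ℝ t := by
      simpa [Function.comp_def] using (hg (u + t • d)).hasFDerivAt.comp_hasDerivAt t hline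
    have hlin := (hasDerivAt_id t).mul_const ⟪g' u, d⟫_ℝ
    have hquad := (hasDerivAt_pow 2 t).const_mul (σ / 2 * ‖d‖ ^ 2)
    refine ((hcomp.sub hlin).sub hquad).congr_deriv ?_
    rw [inner_sub_left]
    push_cast
    ring
  have hφ_mono : MonotoneOn φ (Icc 0 1) := by
    refine monotoneOn_of_deriv_nonneg (convex_Icc 0 1)
      (fun t _ => (hφ t).continuousAt.continuousWithinAt)
      (fun t _ => (hφ t).differentiableAt.differentiableWithinAt) fun t ht => ?_
    rw [interior_Icc] at ht
    rw [(hφ t).deriv]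
    have h := hmono (u + t • d) u
    rw [add_sub_cancel_left, norm_smul, inner_smul_right, mul_pow, Real.norm_eq_abs,
      sq_abs] at h
    have h' : t * (σ * ‖d‖ ^ 2 * t) ≤ t * ⟪g' (u + t • d) - g' u, d⟫_ℝ := by linarith
    exact sub_nonneg.mpr (le_of_mul_le_mul_left h' ht.1)
  have h01 := hφ_mono (left_mem_Icc.mpr zero_le_one) (right_mem_Icc.mpr zero_le_one) zero_le_one
  simp only [φ, zero_smul, one_smul, add_zero, hd, add_sub_cancel] at h01
  linarith

/-- Composition of a strongly convex smooth function with a linear map is quasi-strongly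
convex (Theorem 8 / `the_gAx`): f(x) = g(Ax) has Lg‖A‖²-Lipschitz gradient and, under a
Hoffman-type bound with constant θ for the optimal set, is quasi-strongly convex on X
with constant σg/θ². -/
theorem composition_strongly_convex_linear_map_quasi_strong_convex
    {n m : ℕ} (X Xstar : Set (EuclideanSpace ℝ (Fin n)))
    (A : EuclideanSpace ℝ (Fin n) →L[ℝ] EuclideanSpace ℝ (Fin m))
    (g : EuclideanSpace ℝ (Fin m) → ℝ)
    (g' : EuclideanSpace ℝ (Fin m) → EuclideanSpace ℝ (Fin m))
    (f : EuclideanSpace ℝ (Fin n) → ℝ)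
    (f' proj : EuclideanSpace ℝ (Fin n) → EuclideanSpace ℝ (Fin n))
    (fstar σg Lg θ : ℝ)
    -- X is a nonempty closed convex set, A is a nonzero matrix
    (hXne : X.Nonempty) (hXclosed : IsClosed X) (hXconv : Convex ℝ X)
    (hA : A ≠ 0)
    -- g is σg-strongly convex with Lg-Lipschitz continuous gradient g'
    (hσg : 0 < σg) (hLg : 0 < Lg)
    (hggrad : ∀ u, HasGradientAt g (g' u) u)
    (hgsc : ∀ u v, ⟪g' u - g' v, u - v⟫_ℝ ≥ σg * ‖u - v‖ ^ 2)
    (hgLip : ∀ u v, ‖g' u - g' v‖ ≤ Lg * ‖u - v‖)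
    -- f(x) = g(Ax), with gradient f'
    (hf : ∀ x, f x = g (A x))
    (hfgrad : ∀ x, HasGradientAt f (f' x) x)
    -- Xstar is the (nonempty, closed) set of minimizers of f over X, with optimal value fstar
    (hXstar : Xstar = {x ∈ X | ∀ y ∈ X, f x ≤ f y})
    (hXstar_ne : Xstar.Nonempty) (hXstar_closed : IsClosed Xstar)
    (hfstar : ∀ x ∈ Xstar, f x = fstar)
    -- proj is the Euclidean projection onto Xstar
    (hproj : ∀ x, proj x ∈ Xstar ∧ ∀ y ∈ Xstar, ‖x - proj x‖ ≤ ‖x - y‖)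
    -- Hoffman inequality for the optimal set with constant θ > 0
    (hθ : 0 < θ)
    (hHoffman : ∀ x ∈ X, ‖x - proj x‖ ≤ θ * ‖A x - A (proj x)‖) :
    -- (i) f has Lipschitz continuous gradient with constant Lf = Lg‖A‖², and
    -- (ii) f is quasi-strongly convex on X with constant κf = σg/θ²
    (∀ x y, ‖f' x - f' y‖ ≤ Lg * ‖A‖ ^ 2 * ‖x - y‖) ∧
    (∀ x ∈ X, fstar ≥ f x + ⟪f' x, proj x - x⟫_ℝ + σg / (2 * θ ^ 2) * ‖x - proj x‖ ^ 2) := by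
  have hf' (x) : f' x = ContinuousLinearMap.adjoint A (g' (A x)) := by
    have hfA : f = g ∘ A := funext hf
    exact (hfgrad x).unique (hfA ▸ (hggrad (A x)).comp_continuousLinearMap A)
  refine ⟨fun x y => ?_, fun x hx => ?_⟩
  · calc
      ‖f' x - f' y‖ = ‖ContinuousLinearMap.adjoint A (g' (A x) - g' (A y))‖ := by
        rw [hf', hf', map_sub]
      _ ≤ ‖A‖ * ‖g' (A x) - g' (A y)‖ := by
        simpa only [LinearIsometryEquiv.norm_map] using
          (ContinuousLinearMap.adjoint A).le_opNorm (g' (A x) - g' (A y))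
      _ ≤ ‖A‖ * (Lg * (‖A‖ * ‖x - y‖)) := by
        gcongr
        refine (hgLip _ _).trans ?_
        rw [← map_sub]
        gcongr
        exact A.le_opNorm _
      _ = Lg * ‖A‖ ^ 2 * ‖x - y‖ := by ring
  · have hlower := add_inner_add_sq_le_of_strongly_monotone_gradient hggrad hgsc (A x) (A (proj x))
    have hgrowth : σg / (2 * θ ^ 2) * ‖x - proj x‖ ^ 2 ≤ σg / 2 * ‖A (proj x) - A x‖ ^ 2 := by
      rw [norm_sub_rev (A (proj x))]
      calc
        σg / (2 * θ ^ 2) * ‖x - proj x‖ ^ 2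
            ≤ σg / (2 * θ ^ 2) * (θ * ‖A x - A (proj x)‖) ^ 2 := by
          gcongr
          exact hHoffman x hx
        _ = σg / 2 * ‖A x - A (proj x)‖ ^ 2 := by field_simp
    rw [← hfstar _ (hproj x).1, hf, hf, hf', ContinuousLinearMap.adjoint_inner_left, map_sub]
    linarith
end

section
/- Let A ∈ ℝ^{m×n} be a nonzero matrix, c ∈ ℝ^n, and g : ℝ^m → ℝ a σ_g-strongly convex function with L_g-Lipschitz continuous gradient. Set f(x) = g(Ax) + ⟨c, x⟩ and assume f attains its minimum over ℝ^n with nonempty optimal set X*. If θ > 0 is a constant such that ‖x − x̄‖ ≤ θ‖Ax − Ax̄‖ for all x ∈ ℝ^n (where x̄ = [x]_{X*}), then f has quadratic gradient growth on ℝ^n with constant κ_f = σ_g/θ², i.e., ⟨∇f(x) − ∇f(x̄), x − x̄⟩ ≥ (σ_g/θ²)‖x − x̄‖² for all x ∈ ℝ^n. -/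
open Set
open scoped InnerProductSpace

/-- The gradient of `x ↦ g (A x) + ⟪c, x⟫` is `A† (∇g (A x)) + c`. -/
theorem HasGradientAt.comp_clm_add_inner {E F : Type*}
    [NormedAddCommGroup E] [InnerProductSpace ℝ E] [CompleteSpace E]
    [NormedAddCommGroup F] [InnerProductSpace ℝ F] [CompleteSpace F]
    {g : F → ℝ} {g' : F} (A : E →L[ℝ] F) (c : E) {x : E} (hg : HasGradientAt g g' (A x)) :
    HasGradientAt (fun y => g (A y) + ⟪c, y⟫_ℝ) (A.adjoint g' + c) x := by
  rw [hasGradientAt_iff_hasFDerivAt] at hg ⊢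
  refine ((hg.comp x A.hasFDerivAt).add (innerSL ℝ c).hasFDerivAt).congr_fderiv ?_
  ext y
  simp [ContinuousLinearMap.adjoint_inner_left]

/-- Composition of a strongly convex smooth function with a linear map plus a linear term,
in the unconstrained case, has quadratic gradient growth with constant σg/θ²
(Theorem 9 / `the_gAx+c`). -/
theorem composition_plus_linear_quadratic_gradient_growth
    {n m : ℕ} (Xstar : Set (EuclideanSpace ℝ (Fin n)))
    (A : EuclideanSpace ℝ (Fin n) →L[ℝ] EuclideanSpace ℝ (Fin m))
    (c : EuclideanSpace ℝ (Fin n))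
    (g : EuclideanSpace ℝ (Fin m) → ℝ)
    (g' : EuclideanSpace ℝ (Fin m) → EuclideanSpace ℝ (Fin m))
    (f : EuclideanSpace ℝ (Fin n) → ℝ)
    (f' proj : EuclideanSpace ℝ (Fin n) → EuclideanSpace ℝ (Fin n))
    (σg Lg θ : ℝ)
    -- A is a nonzero matrix
    (hA : A ≠ 0)
    -- g is σg-strongly convex with Lg-Lipschitz continuous gradient g'
    (hσg : 0 < σg) (hLg : 0 < Lg)
    (hggrad : ∀ u, HasGradientAt g (g' u) u)
    (hgsc : ∀ u v, ⟪g' u - g' v, u - v⟫_ℝ ≥ σg * ‖u - v‖ ^ 2)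
    (hgLip : ∀ u v, ‖g' u - g' v‖ ≤ Lg * ‖u - v‖)
    -- f(x) = g(Ax) + ⟨c, x⟩, with gradient f'
    (hf : ∀ x, f x = g (A x) + ⟪c, x⟫_ℝ)
    (hfgrad : ∀ x, HasGradientAt f (f' x) x)
    -- Xstar is the nonempty set of minimizers of f over ℝⁿ
    (hXstar : Xstar = {x | ∀ y, f x ≤ f y})
    (hXstar_ne : Xstar.Nonempty)
    -- proj is the Euclidean projection onto Xstar
    (hproj : ∀ x, proj x ∈ Xstar ∧ ∀ y ∈ Xstar, ‖x - proj x‖ ≤ ‖x - y‖)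
    -- Hoffman inequality for the optimal set with constant θ > 0
    (hθ : 0 < θ)
    (hHoffman : ∀ x, ‖x - proj x‖ ≤ θ * ‖A x - A (proj x)‖) :
    -- conclusion: quadratic gradient growth on ℝⁿ with constant σg/θ²
    ∀ x, ⟪f' x - f' (proj x), x - proj x⟫_ℝ ≥ σg / θ ^ 2 * ‖x - proj x‖ ^ 2 := by
  intro x
  have gradient_eq : ∀ y, f' y = A.adjoint (g' (A y)) + c := fun y =>
    (hfgrad y).unique (funext hf ▸ (hggrad (A y)).comp_clm_add_inner A c)
  have inner_eq : ⟪f' x - f' (proj x), x - proj x⟫_ℝ =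
      ⟪g' (A x) - g' (A (proj x)), A x - A (proj x)⟫_ℝ := by
    rw [gradient_eq, gradient_eq, add_sub_add_right_eq_sub, ← map_sub,
      ContinuousLinearMap.adjoint_inner_left, map_sub]
  calc σg / θ ^ 2 * ‖x - proj x‖ ^ 2
      ≤ σg / θ ^ 2 * (θ * ‖A x - A (proj x)‖) ^ 2 := by
        gcongr
        exact hHoffman x
    _ = σg * ‖A x - A (proj x)‖ ^ 2 := by field_simp
    _ ≤ ⟪f' x - f' (proj x), x - proj x⟫_ℝ := inner_eq ▸ hgsc _ _
end

section
/- Let f be convex with L_f-Lipschitz continuous gradient on X and quasi-strongly convex on X with constant κ_f > 0. For any x ∈ X and any stepsize α with 0 < α ≤ 1/L_f, the projected gradient step x⁺ = [x − α∇f(x)]_X satisfies ‖x⁺ − [x⁺]_{X*}‖² ≤ ((1 − ακ_f)/(1 + ακ_f))·‖x − [x]_{X*}‖². -/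
open Set
open scoped InnerProductSpace

section

variable {E : Type*} [NormedAddCommGroup E] [InnerProductSpace ℝ E]

/-- Derivative of a differentiable function along a line. -/
lemma HasGradientAt.hasDerivAt_comp_line [CompleteSpace E] {f : E → ℝ} {g a v : E} {t : ℝ}
    (h : HasGradientAt f g (a + t • v)) :
    HasDerivAt (fun s : ℝ => f (a + s • v)) ⟪g, v⟫_ℝ t := by
  have hl : HasDerivAt (fun s : ℝ => a + s • v) v t := by
    simpa using ((hasDerivAt_id t).smul_const v).const_add a
  exact (h.hasFDerivAt.comp_hasDerivAt t hl).congr_deriv (by simp)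

/-- The descent lemma on a convex set on which the gradient is Lipschitz. -/
lemma Convex.le_add_inner_gradient_add_sq [CompleteSpace E] {X : Set E} (hX : Convex ℝ X)
    {f : E → ℝ} {f' : E → E} (hgrad : ∀ x, HasGradientAt f (f' x) x) {L : ℝ}
    (hLip : ∀ x ∈ X, ∀ y ∈ X, ‖f' x - f' y‖ ≤ L * ‖x - y‖)
    {x z : E} (hx : x ∈ X) (hz : z ∈ X) :
    f z ≤ f x + ⟪f' x, z - x⟫_ℝ + L / 2 * ‖z - x‖ ^ 2 := by
  set v := z - x with hv
  set ψ : ℝ → ℝ := fun t => f (x + t • v) - t * ⟪f' x, v⟫_ℝ - L / 2 * t ^ 2 * ‖v‖ ^ 2 with hψ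
  have hd : ∀ t, HasDerivAt ψ (⟪f' (x + t • v), v⟫_ℝ - ⟪f' x, v⟫_ℝ - L * t * ‖v‖ ^ 2) t := by
    intro t
    have h1 := (hgrad (x + t • v)).hasDerivAt_comp_line
    have h2 := (hasDerivAt_id t).mul_const ⟪f' x, v⟫_ℝ
    have h3 := (((hasDerivAt_id t).pow 2).const_mul (L / 2)).mul_const (‖v‖ ^ 2)
    refine ((h1.sub h2).sub h3).congr_deriv ?_
    simp only [id_eq, one_mul, mul_one, Nat.cast_ofNat, Nat.add_one_sub_one, pow_one]
    ring
  have hanti : AntitoneOn ψ (Icc 0 1) := by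
    refine antitoneOn_of_deriv_nonpos (convex_Icc 0 1)
      (fun t _ => (hd t).continuousAt.continuousWithinAt)
      (fun t _ => (hd t).differentiableAt.differentiableWithinAt) fun t ht => ?_
    rw [interior_Icc] at ht
    rw [(hd t).deriv, ← inner_sub_left]
    have hmem : x + t • v ∈ X := hX.add_smul_sub_mem hx hz ⟨ht.1.le, ht.2.le⟩
    have h1 := hLip _ hmem _ hx
    rw [add_sub_cancel_left, norm_smul, Real.norm_of_nonneg ht.1.le] at h1
    have h2 := real_inner_le_norm (f' (x + t • v) - f' x) v
    nlinarith [mul_le_mul_of_nonneg_right h1 (norm_nonneg v)]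
  have h := hanti (left_mem_Icc.2 zero_le_one) (right_mem_Icc.2 zero_le_one) zero_le_one
  simp only [hψ, hv, one_smul, add_sub_cancel, zero_smul, add_zero] at h
  linarith

/-- If `q` is a nearest point of `S` to `q + w`, then `q` is the only nearest point of `S`
to the points strictly between them. -/
lemma eq_of_nearest_on_segment_s12 {S : Set E} {q w r : E} {t : ℝ} (ht0 : 0 < t) (ht1 : t < 1)
    (hmin : ∀ y ∈ S, ‖w‖ ≤ ‖q + w - y‖) (hr : r ∈ S)
    (hrq : ‖q + t • w - r‖ ≤ ‖t • w‖) : r = q := by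
  have e1 : q + w - r = w - (r - q) := by abel
  have e2 : q + t • w - r = t • w - (r - q) := by abel
  have h1 := hmin r hr
  rw [e1] at h1
  rw [e2] at hrq
  have h1' := pow_le_pow_left₀ (norm_nonneg _) h1 2
  have h2' := pow_le_pow_left₀ (norm_nonneg _) hrq 2
  rw [norm_sub_sq_real] at h1' h2'
  rw [real_inner_smul_left] at h2'
  have h3 : ‖r - q‖ ^ 2 ≤ 0 := by nlinarith [sq_nonneg ‖r - q‖]
  have h4 : ‖r - q‖ = 0 := by nlinarith [norm_nonneg (r - q)]
  exact sub_eq_zero.1 (norm_eq_zero.1 h4)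

/-- Quasi-strong convexity implies quadratic growth with the same constant. -/
lemma quadratic_growth_of_quasi_strong_convex [CompleteSpace E] {X S : Set E}
    (hX : Convex ℝ X) {f : E → ℝ} {f' proj : E → E} {m κ : ℝ}
    (hgrad : ∀ x, HasGradientAt f (f' x) x) (hSX : S ⊆ X) (hm : ∀ x ∈ X, m ≤ f x)
    (hproj : ∀ x, proj x ∈ S ∧ ∀ y ∈ S, ‖x - proj x‖ ≤ ‖x - y‖)
    (hqsc : ∀ x ∈ X, m ≥ f x + ⟪f' x, proj x - x⟫_ℝ + κ / 2 * ‖x - proj x‖ ^ 2)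
    {z : E} (hz : z ∈ X) : κ / 2 * ‖z - proj z‖ ^ 2 ≤ f z - m := by
  set q := proj z with hq
  set w := z - q with hw
  have hzq : q + w = z := by rw [hw]; abel
  have hmem : ∀ t ∈ Icc (0 : ℝ) 1, q + t • w ∈ X := fun t ht =>
    hX.add_smul_sub_mem (hSX (hproj z).1) hz ht
  set φ : ℝ → ℝ := fun t => (f (q + t • w) - m) / t - κ / 2 * ‖w‖ ^ 2 * t with hφ
  have hd : ∀ t : ℝ, t ≠ 0 → HasDerivAt φ
      ((⟪f' (q + t • w), w⟫_ℝ * t - (f (q + t • w) - m)) / t ^ 2 - κ / 2 * ‖w‖ ^ 2) t := by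
    intro t ht
    have h1 := (((hgrad (q + t • w)).hasDerivAt_comp_line).sub_const m).div (hasDerivAt_id t) ht
    have h2 := (hasDerivAt_id t).const_mul (κ / 2 * ‖w‖ ^ 2)
    refine (h1.sub h2).congr_deriv ?_
    simp
  have hmono : MonotoneOn φ (Ioc 0 1) := by
    refine monotoneOn_of_deriv_nonneg (convex_Ioc 0 1)
      (fun t ht => (hd t ht.1.ne').continuousAt.continuousWithinAt)
      (fun t ht => (hd t (interior_subset ht).1.ne').differentiableAt.differentiableWithinAt)
      fun t ht => ?_
    rw [interior_Ioc] at ht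
    have hpt : proj (q + t • w) = q := by
      refine eq_of_nearest_on_segment_s12 (w := w) ht.1 ht.2 (fun y hy => ?_)
        (hproj (q + t • w)).1 ?_
      · rw [hzq]; exact (hproj z).2 y hy
      · simpa using (hproj (q + t • w)).2 q (hproj z).1
    have h := hqsc _ (hmem t ⟨ht.1.le, ht.2.le⟩)
    rw [hpt, add_sub_cancel_left, sub_add_cancel_left, inner_neg_right, real_inner_smul_right,
      norm_smul, Real.norm_of_nonneg ht.1.le] at h
    rw [(hd t ht.1.ne').deriv, sub_nonneg, le_div_iff₀ (pow_pos ht.1 2)]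
    linarith
  have hlow : ∀ t ∈ Ioc (0 : ℝ) 1, κ / 2 * ‖w‖ ^ 2 * (1 - t) ≤ f z - m := by
    intro t ht
    have h := hmono ht (right_mem_Ioc.2 zero_lt_one) ht.2
    simp only [hφ, one_smul, hzq, div_one, mul_one] at h
    have h0 : 0 ≤ (f (q + t • w) - m) / t :=
      div_nonneg (sub_nonneg.2 (hm _ (hmem t ⟨ht.1.le, ht.2⟩))) ht.1.le
    linarith
  have hlim : Filter.Tendsto (fun t : ℝ => κ / 2 * ‖w‖ ^ 2 * (1 - t)) (nhdsWithin 0 (Ioi 0))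
      (nhds (κ / 2 * ‖w‖ ^ 2)) := by
    have hc : Continuous fun t : ℝ => κ / 2 * ‖w‖ ^ 2 * (1 - t) := by fun_prop
    simpa using (hc.tendsto 0).mono_left nhdsWithin_le_nhds
  exact le_of_tendsto hlim
    (Filter.mem_of_superset (Ioc_mem_nhdsGT zero_lt_one) hlow)

/-- Variational inequality for a nearest point of a convex set. -/
lemma Convex.inner_sub_nearest_nonpos {X : Set E} (hX : Convex ℝ X) {u z y : E} (hz : z ∈ X)
    (hmin : ∀ y ∈ X, ‖u - z‖ ≤ ‖u - y‖) (hy : y ∈ X) : ⟪u - z, y - z⟫_ℝ ≤ 0 := by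
  refine (norm_eq_iInf_iff_real_inner_le_zero hX hz).1 ?_ y hy
  have : Nonempty X := ⟨⟨z, hz⟩⟩
  exact le_antisymm (le_ciInf fun y => hmin y y.2)
    (ciInf_le (f := fun y : X => ‖u - y‖)
      ⟨0, forall_mem_range.2 fun _ => norm_nonneg _⟩ ⟨z, hz⟩)

end

/-- One projected gradient step under quasi-strong convexity contracts the squared distance
to the optimal set by a factor (1 - ακ)/(1 + ακ) (step inequality of Theorem 11 / `th_gm_W`). -/
theorem gm_step_contraction_quasi_strong_convex
    {n : ℕ} (X Xstar : Set (EuclideanSpace ℝ (Fin n)))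
    (f : EuclideanSpace ℝ (Fin n) → ℝ)
    (f' proj projX : EuclideanSpace ℝ (Fin n) → EuclideanSpace ℝ (Fin n))
    (fstar Lf κ : ℝ)
    -- X is a nonempty closed convex set
    (hXne : X.Nonempty) (hXclosed : IsClosed X) (hXconv : Convex ℝ X)
    -- f is convex and continuously differentiable, with gradient f'
    (hconv : ConvexOn ℝ univ f)
    (hsmooth : ContDiff ℝ 1 f)
    (hgrad : ∀ x, HasGradientAt f (f' x) x)
    -- the gradient of f is Lipschitz continuous on X with constant Lf > 0
    (hLf : 0 < Lf)
    (hLip : ∀ x ∈ X, ∀ y ∈ X, ‖f' x - f' y‖ ≤ Lf * ‖x - y‖)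
    -- Xstar is the (nonempty, closed) set of minimizers of f over X, with optimal value fstar
    (hXstar : Xstar = {x ∈ X | ∀ y ∈ X, f x ≤ f y})
    (hXstar_ne : Xstar.Nonempty) (hXstar_closed : IsClosed Xstar)
    (hfstar : ∀ x ∈ Xstar, f x = fstar)
    -- proj is the Euclidean projection onto Xstar
    (hproj : ∀ x, proj x ∈ Xstar ∧ ∀ y ∈ Xstar, ‖x - proj x‖ ≤ ‖x - y‖)
    -- projX is the Euclidean projection onto X
    (hprojX : ∀ u, projX u ∈ X ∧ ∀ y ∈ X, ‖u - projX u‖ ≤ ‖u - y‖)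
    (hκ : 0 < κ)
    -- f is quasi-strongly convex on X with constant κ
    (hqsc : ∀ x ∈ X, fstar ≥ f x + ⟪f' x, proj x - x⟫_ℝ + κ / 2 * ‖x - proj x‖ ^ 2)
    -- stepsize 0 < α ≤ 1/Lf and a point x ∈ X
    (α : ℝ) (hα0 : 0 < α) (hα1 : α ≤ 1 / Lf)
    (x : EuclideanSpace ℝ (Fin n)) (hx : x ∈ X) :
    ‖projX (x - α • f' x) - proj (projX (x - α • f' x))‖ ^ 2 ≤
      (1 - α * κ) / (1 + α * κ) * ‖x - proj x‖ ^ 2 := by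
  have hSX : Xstar ⊆ X := by rw [hXstar]; exact fun y hy => hy.1
  have hm : ∀ y ∈ X, fstar ≤ f y := by
    obtain ⟨s, hs⟩ := hXstar_ne
    intro y hy
    rw [← hfstar s hs]
    rw [hXstar] at hs
    exact hs.2 y hy
  obtain ⟨hzX, hzmin⟩ := hprojX (x - α • f' x)
  set z := projX (x - α • f' x)
  set p := proj x
  have hpS : p ∈ Xstar := (hproj x).1
  have hgrow := quadratic_growth_of_quasi_strong_convex hXconv hgrad hSX hm hproj hqsc hzX
  have hdesc := hXconv.le_add_inner_gradient_add_sq hgrad hLip hx hzX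
  have hvar := hXconv.inner_sub_nearest_nonpos hzX hzmin (hSX hpS)
  have hq := hqsc x hx
  have hzp := pow_le_pow_left₀ (norm_nonneg _) ((hproj z).2 p hpS) 2
  have hαL : α * Lf ≤ 1 := (le_div_iff₀ hLf).1 hα1
  have hsplit : ‖x - p‖ ^ 2 = ‖z - x‖ ^ 2 + ‖z - p‖ ^ 2 + 2 * ⟪x - z, z - p⟫_ℝ := by
    rw [← sub_add_sub_cancel x z p, norm_add_sq_real, norm_sub_rev x z]
    ring
  have hvar' : -⟪x - z, z - p⟫_ℝ ≤ α * (⟪f' x, p - x⟫_ℝ - ⟪f' x, z - x⟫_ℝ) := by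
    rw [← inner_sub_right, sub_sub_sub_cancel_right]
    rw [sub_right_comm, inner_sub_left, real_inner_smul_left, ← neg_sub z p,
      inner_neg_right] at hvar
    rw [← neg_sub z p]
    linarith
  have hden : 0 < 1 + α * κ := by positivity
  rw [div_mul_eq_mul_div, le_div_iff₀ hden]
  nlinarith [mul_le_mul_of_nonneg_left hgrow hα0.le, mul_le_mul_of_nonneg_left hdesc hα0.le,
    mul_le_mul_of_nonneg_left hq.le hα0.le, mul_le_mul_of_nonneg_right hαL (sq_nonneg ‖z - x‖)]
end

section
/- Let f be convex with L_f-Lipschitz continuous gradient on X and quasi-strongly convex on X with constant κ_f > 0, and let μ_f = κ_f/L_f. The projected gradient iterates x^{k+1} = [x^k − (1/L_f)∇f(x^k)]_X, started from x^0 ∈ X, satisfy the linear convergence rate ‖x^k − [x^k]_{X*}‖² ≤ ((1 − μ_f)/(1 + μ_f))^k·‖x^0 − [x^0]_{X*}‖² for all k ≥ 0. -/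
open Set
open scoped InnerProductSpace

/-- Variational characterization of a nearest point of a convex set. -/
lemma real_inner_sub_le_zero_of_nearest {E : Type*} [NormedAddCommGroup E]
    [InnerProductSpace ℝ E] {C : Set E} (hC : Convex ℝ C) {u p : E} (hp : p ∈ C)
    (hmin : ∀ y ∈ C, ‖u - p‖ ≤ ‖u - y‖) : ∀ y ∈ C, ⟪u - p, y - p⟫_ℝ ≤ 0 := by
  have : Nonempty C := ⟨⟨p, hp⟩⟩
  refine (norm_eq_iInf_iff_real_inner_le_zero hC hp).1 (le_antisymm ?_ ?_)
  · exact le_ciInf fun y => hmin y y.2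
  · exact ciInf_le (f := fun w : C => ‖u - w‖)
      ⟨0, by rintro _ ⟨w, rfl⟩; exact norm_nonneg _⟩ ⟨p, hp⟩

lemma nearest_point_segment {E : Type*} [NormedAddCommGroup E]
    [InnerProductSpace ℝ E] {C : Set E} (hC : Convex ℝ C) {x p q : E} {t : ℝ} (ht : 0 ≤ t)
    (hp : p ∈ C) (hpmin : ∀ y ∈ C, ‖x - p‖ ≤ ‖x - y‖)
    (hq : q ∈ C) (hqmin : ∀ y ∈ C, ‖p + t • (x - p) - q‖ ≤ ‖p + t • (x - p) - y‖) :
    q = p := by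
  have h1 := real_inner_sub_le_zero_of_nearest hC hp hpmin q hq
  have h2 := real_inner_sub_le_zero_of_nearest hC hq hqmin p hp
  have h3 : ⟪p + t • (x - p) - q, p - q⟫_ℝ = ‖p - q‖ ^ 2 - t * ⟪x - p, q - p⟫_ℝ := by
    rw [show p + t • (x - p) - q = (p - q) + t • (x - p) by abel, inner_add_left,
      real_inner_self_eq_norm_sq, real_inner_smul_left, ← neg_sub q p, inner_neg_right]
    ring
  have h4 : ‖p - q‖ ^ 2 ≤ 0 := by nlinarith [mul_nonneg ht (neg_nonneg.2 h1)]
  have h5 : ‖p - q‖ = 0 := by nlinarith [norm_nonneg (p - q)]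
  exact (sub_eq_zero.1 (norm_eq_zero.1 h5)).symm

lemma HasGradientAt.hasDerivAt_add_smul {E : Type*} [NormedAddCommGroup E]
    [InnerProductSpace ℝ E] [CompleteSpace E] {f : E → ℝ} {g x v : E} {t : ℝ}
    (h : HasGradientAt f g (x + t • v)) :
    HasDerivAt (fun s : ℝ => f (x + s • v)) ⟪g, v⟫_ℝ t := by
  have hl : HasDerivAt (fun s : ℝ => x + s • v) v t := by
    simpa using ((hasDerivAt_id t).smul_const v).const_add x
  exact (h.hasFDerivAt.comp_hasDerivAt t hl).congr_deriv (by simp)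

/-- Descent lemma for a gradient that is Lipschitz on a convex set. -/
lemma le_add_inner_add_norm_sq_of_lipschitz_gradient {E : Type*} [NormedAddCommGroup E]
    [InnerProductSpace ℝ E] [CompleteSpace E] {X : Set E} (hX : Convex ℝ X) {f : E → ℝ}
    {f' : E → E} {L : ℝ} (hgrad : ∀ x, HasGradientAt f (f' x) x)
    (hLip : ∀ x ∈ X, ∀ y ∈ X, ‖f' x - f' y‖ ≤ L * ‖x - y‖) {x y : E} (hx : x ∈ X)
    (hy : y ∈ X) : f y ≤ f x + ⟪f' x, y - x⟫_ℝ + L / 2 * ‖y - x‖ ^ 2 := by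
  have hd : ∀ t : ℝ, HasDerivAt
      (fun s : ℝ => f (x + s • (y - x)) - s * ⟪f' x, y - x⟫_ℝ - s ^ 2 * (L / 2 * ‖y - x‖ ^ 2))
      (⟪f' (x + t • (y - x)), y - x⟫_ℝ - ⟪f' x, y - x⟫_ℝ - 2 * t * (L / 2 * ‖y - x‖ ^ 2)) t := by
    intro t
    have h1 := (hgrad (x + t • (y - x))).hasDerivAt_add_smul
    have h2 := (hasDerivAt_id t).mul_const ⟪f' x, y - x⟫_ℝ
    have h3 := (hasDerivAt_pow 2 t).mul_const (L / 2 * ‖y - x‖ ^ 2)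
    exact ((h1.sub h2).sub h3).congr_deriv (by simp)
  have hanti := antitoneOn_of_deriv_nonpos (convex_Icc (0 : ℝ) 1)
    (fun t _ => (hd t).continuousAt.continuousWithinAt)
    (fun t _ => (hd t).differentiableAt.differentiableWithinAt) (by
      intro t ht
      rw [interior_Icc] at ht
      rw [(hd t).deriv, ← inner_sub_left]
      have hm := hLip _ (hX.add_smul_sub_mem hx hy ⟨ht.1.le, ht.2.le⟩) x hx
      rw [add_sub_cancel_left, norm_smul, Real.norm_of_nonneg ht.1.le] at hm
      have hcs := real_inner_le_norm (f' (x + t • (y - x)) - f' x) (y - x)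
      nlinarith [mul_le_mul_of_nonneg_right hm (norm_nonneg (y - x))])
  have h := hanti (left_mem_Icc.2 zero_le_one) (right_mem_Icc.2 zero_le_one) zero_le_one
  simp at h
  linarith

/-- Quadratic growth from the quasi-strong convexity inequality along the segment from a
minimizer `p` to `x`. -/
lemma quadratic_growth_of_quasi_strong_convex_segment {E : Type*} [NormedAddCommGroup E]
    [InnerProductSpace ℝ E] [CompleteSpace E] {f : E → ℝ} {f' : E → E} {m κ : ℝ} {p x : E}
    (hgrad : ∀ x, HasGradientAt f (f' x) x)
    (hm : ∀ t ∈ Ioc (0 : ℝ) 1, m ≤ f (p + t • (x - p)))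
    (hqsc : ∀ t ∈ Ioc (0 : ℝ) 1, f (p + t • (x - p)) - t * ⟪f' (p + t • (x - p)), x - p⟫_ℝ
      + κ / 2 * (t ^ 2 * ‖x - p‖ ^ 2) ≤ m) :
    m + κ / 2 * ‖x - p‖ ^ 2 ≤ f x := by
  have hd : ∀ t ∈ Ioc (0 : ℝ) 1, HasDerivAt
      (fun s : ℝ => (f (p + s • (x - p)) - m) / s - s * (κ / 2 * ‖x - p‖ ^ 2))
      ((⟪f' (p + t • (x - p)), x - p⟫_ℝ * t - (f (p + t • (x - p)) - m)) / t ^ 2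
        - κ / 2 * ‖x - p‖ ^ 2) t := by
    intro t ht
    have h1 := (hgrad (p + t • (x - p))).hasDerivAt_add_smul.sub_const m
    have h2 := (hasDerivAt_id t).mul_const (κ / 2 * ‖x - p‖ ^ 2)
    exact ((h1.div (hasDerivAt_id t) ht.1.ne').sub h2).congr_deriv (by simp)
  have hmono := monotoneOn_of_deriv_nonneg (convex_Ioc (0 : ℝ) 1)
    (fun t ht => (hd t ht).continuousAt.continuousWithinAt)
    (fun t ht => (hd t (interior_subset ht)).differentiableAt.differentiableWithinAt) (by
      intro t ht
      have ht' := interior_subset ht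
      have hq := hqsc t ht'
      rw [(hd t ht').deriv, sub_nonneg, le_div_iff₀ (pow_pos ht'.1 2)]
      linarith)
  have hbound : ∀ t ∈ Ioc (0 : ℝ) 1,
      κ / 2 * ‖x - p‖ ^ 2 - t * (κ / 2 * ‖x - p‖ ^ 2) ≤ f x - m := by
    intro t ht
    have h := hmono ht (right_mem_Ioc.2 zero_lt_one) ht.2
    have h0 := div_nonneg (sub_nonneg.2 (hm t ht)) ht.1.le
    simp at h
    linarith
  have hlim : Filter.Tendsto
      (fun t : ℝ => κ / 2 * ‖x - p‖ ^ 2 - t * (κ / 2 * ‖x - p‖ ^ 2)) (nhdsWithin 0 (Ioi 0))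
      (nhds (κ / 2 * ‖x - p‖ ^ 2)) := by
    refine Filter.Tendsto.mono_left ?_ nhdsWithin_le_nhds
    refine (Continuous.tendsto' (by fun_prop) _ _ (by simp))
  have := le_of_tendsto hlim
    (Filter.mem_of_superset (Ioc_mem_nhdsGT zero_lt_one) hbound)
  linarith

/-- A nonnegative sequence with `a (k + 1) ≤ q * a k` decays geometrically, whatever the sign
of `q`. -/
lemma le_pow_mul_of_succ_le_mul {a : ℕ → ℝ} {q : ℝ} (ha : ∀ k, 0 ≤ a k)
    (h : ∀ k, a (k + 1) ≤ q * a k) (k : ℕ) : a k ≤ q ^ k * a 0 := by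
  rcases le_or_gt 0 q with hq | hq
  · induction k with
    | zero => simp
    | succ k ih =>
      calc a (k + 1) ≤ q * a k := h k
        _ ≤ q * (q ^ k * a 0) := mul_le_mul_of_nonneg_left ih hq
        _ = q ^ (k + 1) * a 0 := by ring
  · have hz : ∀ k, a k = 0 := fun k => by nlinarith [ha k, ha (k + 1), h k]
    simp [hz]

/-- Linear convergence of the projected gradient method for quasi-strongly convex functions
(Theorem 11 / `th_gm_W`): ‖xᵏ - x̄ᵏ‖² ≤ ((1-μ)/(1+μ))ᵏ ‖x⁰ - x̄⁰‖² with μ = κ/Lf. -/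
theorem gm_linear_convergence_quasi_strong_convex
    {n : ℕ} (X Xstar : Set (EuclideanSpace ℝ (Fin n)))
    (f : EuclideanSpace ℝ (Fin n) → ℝ)
    (f' proj projX : EuclideanSpace ℝ (Fin n) → EuclideanSpace ℝ (Fin n))
    (fstar Lf κ : ℝ)
    -- X is a nonempty closed convex set
    (hXne : X.Nonempty) (hXclosed : IsClosed X) (hXconv : Convex ℝ X)
    -- f is convex and continuously differentiable, with gradient f'
    (hconv : ConvexOn ℝ univ f)
    (hsmooth : ContDiff ℝ 1 f)
    (hgrad : ∀ x, HasGradientAt f (f' x) x)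
    -- the gradient of f is Lipschitz continuous on X with constant Lf > 0
    (hLf : 0 < Lf)
    (hLip : ∀ x ∈ X, ∀ y ∈ X, ‖f' x - f' y‖ ≤ Lf * ‖x - y‖)
    -- Xstar is the (nonempty, closed) set of minimizers of f over X, with optimal value fstar
    (hXstar : Xstar = {x ∈ X | ∀ y ∈ X, f x ≤ f y})
    (hXstar_ne : Xstar.Nonempty) (hXstar_closed : IsClosed Xstar)
    (hfstar : ∀ x ∈ Xstar, f x = fstar)
    -- proj is the Euclidean projection onto Xstar
    (hproj : ∀ x, proj x ∈ Xstar ∧ ∀ y ∈ Xstar, ‖x - proj x‖ ≤ ‖x - y‖)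
    -- projX is the Euclidean projection onto X
    (hprojX : ∀ u, projX u ∈ X ∧ ∀ y ∈ X, ‖u - projX u‖ ≤ ‖u - y‖)
    (hκ : 0 < κ)
    -- f is quasi-strongly convex on X with constant κ
    (hqsc : ∀ x ∈ X, fstar ≥ f x + ⟪f' x, proj x - x⟫_ℝ + κ / 2 * ‖x - proj x‖ ^ 2)
    -- projected gradient iterates with constant stepsize 1/Lf, started from x⁰ ∈ X
    (x : ℕ → EuclideanSpace ℝ (Fin n))
    (hx0 : x 0 ∈ X)
    (hiter : ∀ k, x (k + 1) = projX (x k - (1 / Lf) • f' (x k)))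
    :
    ∀ k : ℕ, ‖x k - proj (x k)‖ ^ 2 ≤
      ((1 - κ / Lf) / (1 + κ / Lf)) ^ k * ‖x 0 - proj (x 0)‖ ^ 2 := by
  have hXs : ∀ y, y ∈ Xstar ↔ y ∈ X ∧ ∀ z ∈ X, f y ≤ f z := fun y => by
    rw [hXstar]; exact Iff.rfl
  have hconvS : Convex ℝ Xstar := by
    obtain ⟨w, hw⟩ := hXstar_ne
    have : Xstar = {y ∈ X | f y ≤ f w} := by
      ext y
      refine ⟨fun hy => ⟨((hXs y).1 hy).1, ((hXs y).1 hy).2 w ((hXs w).1 hw).1⟩, fun hy => ?_⟩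
      exact (hXs y).2 ⟨hy.1, fun z hz => hy.2.trans (((hXs w).1 hw).2 z hz)⟩
    rw [this]
    exact (hconv.subset (subset_univ X) hXconv).convex_le (f w)
  have hmin : ∀ y ∈ X, fstar ≤ f y := by
    obtain ⟨w, hw⟩ := hXstar_ne
    intro y hy
    rw [← hfstar w hw]
    exact ((hXs w).1 hw).2 y hy
  have hgrowth : ∀ y ∈ X, fstar + κ / 2 * ‖y - proj y‖ ^ 2 ≤ f y := by
    intro y hy
    have hpX := ((hXs _).1 (hproj y).1).1
    have hmem : ∀ t ∈ Ioc (0 : ℝ) 1, proj y + t • (y - proj y) ∈ X := fun t ht =>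
      hXconv.add_smul_sub_mem hpX hy ⟨ht.1.le, ht.2⟩
    refine quadratic_growth_of_quasi_strong_convex_segment hgrad
      (fun t ht => hmin _ (hmem t ht)) fun t ht => ?_
    have hq := hqsc _ (hmem t ht)
    rw [nearest_point_segment hconvS ht.1.le (hproj y).1 (hproj y).2 (hproj _).1 (hproj _).2,
      sub_add_cancel_left, add_sub_cancel_left, inner_neg_right, real_inner_smul_right,
      norm_smul, mul_pow, Real.norm_of_nonneg ht.1.le] at hq
    linarith
  have hxX : ∀ k, x k ∈ X := by
    intro k
    cases k with
    | zero => exact hx0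
    | succ k => rw [hiter]; exact (hprojX _).1
  refine le_pow_mul_of_succ_le_mul (a := fun k => ‖x k - proj (x k)‖ ^ 2)
    (fun k => sq_nonneg _) fun k => ?_
  have hpX := ((hXs _).1 (hproj (x k)).1).1
  have hdesc := le_add_inner_add_norm_sq_of_lipschitz_gradient hXconv hgrad hLip
    (hxX k) (hxX (k + 1))
  have hvar := real_inner_sub_le_zero_of_nearest hXconv (hprojX _).1
    (hprojX (x k - (1 / Lf) • f' (x k))).2 (proj (x k)) hpX
  rw [← hiter k] at hvar
  have hq := hqsc _ (hxX k)
  have hg := hgrowth _ (hxX (k + 1))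
  have hle : ‖x (k + 1) - proj (x (k + 1))‖ ^ 2 ≤ ‖x (k + 1) - proj (x k)‖ ^ 2 :=
    pow_le_pow_left₀ (norm_nonneg _) ((hproj _).2 _ (hproj _).1) 2
  generalize proj (x (k + 1)) = p' at *
  generalize proj (x k) = p at *
  generalize x (k + 1) = y at *
  generalize f' (x k) = g at *
  generalize x k = z at *
  have hpolar : ‖z - p‖ ^ 2 = ‖z - y‖ ^ 2 + 2 * ⟪z - y, y - p⟫_ℝ + ‖y - p‖ ^ 2 := by
    rw [← norm_add_sq_real, sub_add_sub_cancel]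
  have hsplit : ⟪z - (1 / Lf) • g - y, p - y⟫_ℝ
      = 1 / Lf * ⟪g, y - p⟫_ℝ - ⟪z - y, y - p⟫_ℝ := by
    rw [sub_right_comm, inner_sub_left, real_inner_smul_left, ← neg_sub y p, inner_neg_right,
      inner_neg_right]
    ring
  have hvar' : ⟪g, y - p⟫_ℝ ≤ Lf * ⟪z - y, y - p⟫_ℝ := by
    rw [hsplit, sub_nonpos, one_div, inv_mul_le_iff₀ hLf] at hvar
    exact hvar
  have hinner : ⟪g, y - z⟫_ℝ = ⟪g, y - p⟫_ℝ + ⟪g, p - z⟫_ℝ := by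
    rw [← inner_add_right, sub_add_sub_cancel]
  rw [hinner, norm_sub_rev y z] at hdesc
  have hrate : (1 - κ / Lf) / (1 + κ / Lf) = (Lf - κ) / (Lf + κ) := by
    field_simp
  rw [hrate, div_mul_eq_mul_div, le_div_iff₀ (by linarith)]
  nlinarith [mul_le_mul_of_nonneg_left hle hLf.le]
end

section
/- Let f be convex with L_f-Lipschitz continuous gradient on X and satisfy the quadratic functional growth condition on X with constant κ_f > 0. For any x ∈ X and any stepsize α with 0 < α ≤ 1/L_f, the projected gradient step x⁺ = [x − α∇f(x)]_X satisfies ‖x⁺ − [x⁺]_{X*}‖² ≤ (1/(1 + ακ_f))·‖x − [x]_{X*}‖². -/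
open Set
open scoped InnerProductSpace

section

variable {E : Type*} [NormedAddCommGroup E] [InnerProductSpace ℝ E]

/-- The variational inequality characterizing a nearest point `v` of a convex set. -/
theorem inner_sub_sub_nonpos_of_forall_norm_sub_le {K : Set E} (hK : Convex ℝ K) {u v : E}
    (hv : v ∈ K) (hmin : ∀ y ∈ K, ‖u - v‖ ≤ ‖u - y‖) {w : E} (hw : w ∈ K) :
    ⟪u - v, w - v⟫_ℝ ≤ 0 := by
  have : Nonempty K := ⟨⟨v, hv⟩⟩
  refine (norm_eq_iInf_iff_real_inner_le_zero hK hv).1 (le_antisymm ?_ ?_) w hw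
  · exact le_ciInf fun y => hmin y y.2
  · exact ciInf_le (f := fun y : K => ‖u - y‖) ⟨0, by rintro _ ⟨y, rfl⟩; positivity⟩ ⟨v, hv⟩

variable [CompleteSpace E]

theorem HasGradientAt.hasDerivAt_comp_add_smul {f : E → ℝ} {g x d : E} {t : ℝ}
    (h : HasGradientAt f g (x + t • d)) :
    HasDerivAt (fun s : ℝ => f (x + s • d)) ⟪g, d⟫_ℝ t := by
  have hline : HasDerivAt (fun s : ℝ => x + s • d) d t := by
    simpa using ((hasDerivAt_id t).smul_const d).const_add x
  simpa [Function.comp_def] using h.hasFDerivAt.comp_hasDerivAt t hline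

/-- First-order lower bound for a convex function. -/
theorem ConvexOn.inner_gradient_le_sub {f : E → ℝ} {g x : E} (hf : ConvexOn ℝ univ f)
    (hg : HasGradientAt f g x) (y : E) : ⟪g, y - x⟫_ℝ ≤ f y - f x := by
  have hconv : ConvexOn ℝ univ (fun s : ℝ => f (x + s • (y - x))) := by
    have := hf.comp_affineMap (AffineMap.lineMap x y : ℝ →ᵃ[ℝ] E)
    refine this.congr fun s _ => ?_
    simp [AffineMap.lineMap_apply, add_comm]
  have hd : HasDerivAt (fun s : ℝ => f (x + s • (y - x))) ⟪g, y - x⟫_ℝ 0 :=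
    HasGradientAt.hasDerivAt_comp_add_smul (by simpa using hg)
  simpa [slope] using hconv.le_slope_of_hasDerivAt (mem_univ 0) (mem_univ 1) one_pos hd

/-- The descent lemma on a convex set. -/
theorem sub_le_inner_gradient_add_of_lipschitz {f : E → ℝ} {f' : E → E} {X : Set E} {L : ℝ}
    (hX : Convex ℝ X) (hgrad : ∀ x, HasGradientAt f (f' x) x)
    (hLip : ∀ x ∈ X, ∀ y ∈ X, ‖f' x - f' y‖ ≤ L * ‖x - y‖) {x y : E} (hx : x ∈ X) (hy : y ∈ X) :
    f y - f x ≤ ⟪f' x, y - x⟫_ℝ + L / 2 * ‖y - x‖ ^ 2 := by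
  set d := y - x with hd
  have hderiv (t : ℝ) : HasDerivAt
      (fun s : ℝ => f (x + s • d) - s * ⟪f' x, d⟫_ℝ - L / 2 * ‖d‖ ^ 2 * s ^ 2)
      (⟪f' (x + t • d), d⟫_ℝ - ⟪f' x, d⟫_ℝ - L * ‖d‖ ^ 2 * t) t := by
    refine (((hgrad _).hasDerivAt_comp_add_smul.sub
      ((hasDerivAt_id t).mul_const ⟪f' x, d⟫_ℝ)).sub
      ((hasDerivAt_pow 2 t).const_mul (L / 2 * ‖d‖ ^ 2))).congr_deriv ?_
    norm_num
    ring
  have hanti : AntitoneOn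
      (fun s : ℝ => f (x + s • d) - s * ⟪f' x, d⟫_ℝ - L / 2 * ‖d‖ ^ 2 * s ^ 2) (Icc 0 1) := by
    refine antitoneOn_of_deriv_nonpos (convex_Icc 0 1)
      (fun t _ => (hderiv t).continuousAt.continuousWithinAt)
      (fun t _ => (hderiv t).differentiableAt.differentiableWithinAt) fun t ht => ?_
    rw [interior_Icc] at ht
    rw [(hderiv t).deriv, ← inner_sub_left]
    have hmem : x + t • d ∈ X := hX.add_smul_sub_mem hx hy ⟨ht.1.le, ht.2.le⟩
    have hnorm : ‖f' (x + t • d) - f' x‖ ≤ L * (t * ‖d‖) := by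
      simpa [norm_smul, abs_of_pos ht.1] using hLip _ hmem _ hx
    nlinarith [real_inner_le_norm (f' (x + t • d) - f' x) d,
      mul_le_mul_of_nonneg_right hnorm (norm_nonneg d)]
  have h01 := hanti (left_mem_Icc.2 zero_le_one) (right_mem_Icc.2 zero_le_one) zero_le_one
  simp [hd] at h01
  linarith

/-- The basic estimate for a projected gradient step `z` from `x`, against any point `p`. -/
theorem norm_sq_projected_gradient_step_le {f : E → ℝ} {f' : E → E} {X : Set E} {L α : ℝ}
    (hX : Convex ℝ X) (hconv : ConvexOn ℝ univ f) (hgrad : ∀ x, HasGradientAt f (f' x) x)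
    (hLip : ∀ x ∈ X, ∀ y ∈ X, ‖f' x - f' y‖ ≤ L * ‖x - y‖) (hα : 0 ≤ α) (hαL : α * L ≤ 1)
    {x z p : E} (hx : x ∈ X) (hz : z ∈ X) (hp : p ∈ X)
    (hmin : ∀ y ∈ X, ‖x - α • f' x - z‖ ≤ ‖x - α • f' x - y‖) :
    ‖z - p‖ ^ 2 ≤ ‖x - p‖ ^ 2 - 2 * α * (f z - f p) := by
  have hvar := inner_sub_sub_nonpos_of_forall_norm_sub_le hX hz hmin hp
  have hsplit : ⟪x - α • f' x - z, p - z⟫_ℝ =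
      ⟪z - x, z - p⟫_ℝ - α * (⟪f' x, p - x⟫_ℝ - ⟪f' x, z - x⟫_ℝ) := by
    rw [← inner_sub_right, ← real_inner_smul_left, ← inner_neg_neg (z - x) (z - p), neg_sub,
      neg_sub, sub_sub_sub_cancel_right, ← inner_sub_left, sub_right_comm]
  have hexp : ‖x - p‖ ^ 2 = ‖z - p‖ ^ 2 - 2 * ⟪z - x, z - p⟫_ℝ + ‖z - x‖ ^ 2 := by
    rw [real_inner_comm, ← norm_sub_sq_real, sub_sub_sub_cancel_left]
  have hlow := mul_le_mul_of_nonneg_left (hconv.inner_gradient_le_sub (hgrad x) p) hα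
  have hup := mul_le_mul_of_nonneg_left
    (sub_le_inner_gradient_add_of_lipschitz hX hgrad hLip hx hz) hα
  nlinarith [mul_le_mul_of_nonneg_right hαL (sq_nonneg ‖z - x‖)]

end

/-- One projected gradient step under quadratic functional growth contracts the squared
distance to the optimal set by a factor 1/(1 + ακ) (step inequality of Theorem 12 / `th_gm_S`). -/
theorem gm_step_contraction_quadratic_functional_growth
    {n : ℕ} (X Xstar : Set (EuclideanSpace ℝ (Fin n)))
    (f : EuclideanSpace ℝ (Fin n) → ℝ)
    (f' proj projX : EuclideanSpace ℝ (Fin n) → EuclideanSpace ℝ (Fin n))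
    (fstar Lf κ : ℝ)
    -- X is a nonempty closed convex set
    (hXne : X.Nonempty) (hXclosed : IsClosed X) (hXconv : Convex ℝ X)
    -- f is convex and continuously differentiable, with gradient f'
    (hconv : ConvexOn ℝ univ f)
    (hsmooth : ContDiff ℝ 1 f)
    (hgrad : ∀ x, HasGradientAt f (f' x) x)
    -- the gradient of f is Lipschitz continuous on X with constant Lf > 0
    (hLf : 0 < Lf)
    (hLip : ∀ x ∈ X, ∀ y ∈ X, ‖f' x - f' y‖ ≤ Lf * ‖x - y‖)
    -- Xstar is the (nonempty, closed) set of minimizers of f over X, with optimal value fstar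
    (hXstar : Xstar = {x ∈ X | ∀ y ∈ X, f x ≤ f y})
    (hXstar_ne : Xstar.Nonempty) (hXstar_closed : IsClosed Xstar)
    (hfstar : ∀ x ∈ Xstar, f x = fstar)
    -- proj is the Euclidean projection onto Xstar
    (hproj : ∀ x, proj x ∈ Xstar ∧ ∀ y ∈ Xstar, ‖x - proj x‖ ≤ ‖x - y‖)
    -- projX is the Euclidean projection onto X
    (hprojX : ∀ u, projX u ∈ X ∧ ∀ y ∈ X, ‖u - projX u‖ ≤ ‖u - y‖)
    (hκ : 0 < κ)
    -- f has quadratic functional growth on X with constant κ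
    (hqfg : ∀ x ∈ X, f x - fstar ≥ κ / 2 * ‖x - proj x‖ ^ 2)
    -- stepsize 0 < α ≤ 1/Lf and a point x ∈ X
    (α : ℝ) (hα0 : 0 < α) (hα1 : α ≤ 1 / Lf)
    (x : EuclideanSpace ℝ (Fin n)) (hx : x ∈ X) :
    ‖projX (x - α • f' x) - proj (projX (x - α • f' x))‖ ^ 2 ≤
      1 / (1 + α * κ) * ‖x - proj x‖ ^ 2 := by
  obtain ⟨hz, hmin⟩ := hprojX (x - α • f' x)
  set z := projX (x - α • f' x)
  have hp := (hproj x).1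
  have hpX : proj x ∈ X := (hXstar ▸ hp : proj x ∈ {x ∈ X | ∀ y ∈ X, f x ≤ f y}).1
  have hstep := norm_sq_projected_gradient_step_le hXconv hconv hgrad hLip hα0.le
    ((le_div_iff₀ hLf).1 hα1) hx hz hpX hmin
  rw [hfstar _ hp] at hstep
  have hgrowth := mul_le_mul_of_nonneg_left (hqfg z hz) hα0.le
  have hdist : ‖z - proj z‖ ^ 2 ≤ ‖z - proj x‖ ^ 2 := by
    gcongr
    exact (hproj z).2 _ hp
  rw [one_div, inv_mul_eq_div, le_div_iff₀ (by positivity)]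
  linarith
end
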